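/- Let f : [0,1]^J → ℝ be continuous and strictly positive, let m : [0,1]^J → ℝ be continuous, let 𝔏 be a finite family of distinct nonempty subsets of 𝐉 = {1,…,J} with nonzero real coefficients (c_l) that contains the full set l̃ = 𝐉, and define G(q) = ∑_{l∈𝔏} c_l ∫_{A_l(q)} m(v) f(v) dv. Then for every v ∈ (0,1)^J, the mixed partial derivative ∂^J G/∂q_1⋯∂q_J exists at q = v and m(v) = (1/(c_{l̃} f(v))) · ∂^J G/∂q_1⋯∂q_J (v); that is, the function m is point identified everywhere on (0,1)^J from G and f. -/

import Mathlib

open MeasureTheory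

/-- `HasPartialDerivAt G j q v`: the partial derivative of `G : ℝ^J → ℝ` with respect to
the `j`-th coordinate exists at the point `q` and equals `v`. -/
def HasPartialDerivAt {J : ℕ} (G : (Fin J → ℝ) → ℝ) (j : Fin J)
    (q : Fin J → ℝ) (v : ℝ) : Prop :=
  HasDerivAt (fun t : ℝ => G (Function.update q j t)) v (q j)

/-- `HasMixedPartialOn S G L h`: on the set `S`, the iterated partial derivatives of `G`
taken successively once with respect to each coordinate in the list `L` exist, and the
resulting function coincides with `h` on `S`. -/
def HasMixedPartialOn {J : ℕ} (S : Set (Fin J → ℝ)) :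
    ((Fin J → ℝ) → ℝ) → List (Fin J) → ((Fin J → ℝ) → ℝ) → Prop
  | G, [], h => ∀ q ∈ S, G q = h q
  | G, j :: L, h => ∃ G' : (Fin J → ℝ) → ℝ,
      (∀ q ∈ S, HasPartialDerivAt G j q (G' q)) ∧ HasMixedPartialOn S G' L h

/-- `α_l(q)`: the corner with `α_l(q)_j = q_j` for `j ∈ l` and `= 1` for `j ∉ l`. -/
def alphaCorner {J : ℕ} (l : Finset (Fin J)) (q : Fin J → ℝ) : Fin J → ℝ :=
  fun j => if j ∈ l then q j else 1

section MixedPartial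

variable {J : ℕ} {S : Set (Fin J → ℝ)}

/-- On an open set, iterated partial derivatives only depend on the values on that set. -/
lemma HasMixedPartialOn.congr (hS : IsOpen S) {L : List (Fin J)} {G₁ G₂ h : (Fin J → ℝ) → ℝ}
    (H : HasMixedPartialOn S G₁ L h) (hEq : Set.EqOn G₂ G₁ S) : HasMixedPartialOn S G₂ L h := by
  cases L with
  | nil => exact fun q hq => (hEq hq).trans (H q hq)
  | cons j L =>
    obtain ⟨G', hG', H'⟩ := H
    refine ⟨G', fun q hq => (hG' q hq).congr_of_eventuallyEq ?_, H'⟩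
    have hcont : Continuous fun t : ℝ => Function.update q j t :=
      continuous_const.update j continuous_id
    have hmem : ∀ᶠ t in nhds (q j), Function.update q j t ∈ S :=
      hcont.continuousAt.eventually_mem (hS.mem_nhds (by simpa using hq))
    filter_upwards [hmem] with t ht using hEq ht

lemma hasMixedPartialOn_zero (L : List (Fin J)) :
    HasMixedPartialOn S (fun _ => 0) L (fun _ => 0) := by
  induction L with
  | nil => exact fun _ _ => rfl
  | cons j L ih => exact ⟨fun _ => 0, fun q _ => hasDerivAt_const _ _, ih⟩

lemma HasMixedPartialOn.sum_const_mul {ι : Type*} (s : Finset ι) (c : ι → ℝ) {L : List (Fin J)}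
    {G h : ι → (Fin J → ℝ) → ℝ} (H : ∀ i ∈ s, HasMixedPartialOn S (G i) L (h i)) :
    HasMixedPartialOn S (fun q => ∑ i ∈ s, c i * G i q) L (fun q => ∑ i ∈ s, c i * h i q) := by
  induction L generalizing G with
  | nil => exact fun q hq => Finset.sum_congr rfl fun i hi => by rw [H i hi q hq]
  | cons j L ih =>
    choose! G' hG' H' using H
    exact ⟨fun q => ∑ i ∈ s, c i * G' i q,
      fun q hq => HasDerivAt.fun_sum fun i hi => (hG' i hi q hq).const_mul (c i), ih H'⟩

end MixedPartial

section IteratedIntegral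

variable {n : ℕ}

/-- Successive integration of `Φ` over the coordinates in a list, the first one outermost, where
the `j`-th coordinate ranges from `0` to `u j (q j)`. -/
noncomputable def iteratedIntegral (u : Fin n → ℝ → ℝ) (Φ : (Fin n → ℝ) → ℝ) :
    List (Fin n) → (Fin n → ℝ) → ℝ
  | [], q => Φ q
  | j :: L, q => ∫ t in (0 : ℝ)..u j (q j), iteratedIntegral u Φ L (Function.update q j t)

lemma continuous_iteratedIntegral {u : Fin n → ℝ → ℝ} (hu : ∀ j, Continuous (u j))
    {Φ : (Fin n → ℝ) → ℝ} (hΦ : Continuous Φ) (L : List (Fin n)) :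
    Continuous (iteratedIntegral u Φ L) := by
  induction L with
  | nil => exact hΦ
  | cons j L ih =>
    refine intervalIntegral.continuous_parametric_intervalIntegral_of_continuous
      (f := fun q t => iteratedIntegral u Φ L (Function.update q j t)) ?_
      ((hu j).comp (continuous_apply j))
    exact ih.comp (continuous_fst.update j continuous_snd)

lemma iteratedIntegral_map_succ (u : Fin (n + 1) → ℝ → ℝ) (Φ : (Fin (n + 1) → ℝ) → ℝ)
    (L : List (Fin n)) (t : ℝ) (w : Fin n → ℝ) :
    iteratedIntegral u Φ (L.map Fin.succ) (Fin.cons t w) =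
      iteratedIntegral (fun j => u j.succ) (fun w => Φ (Fin.cons t w)) L w := by
  induction L generalizing w with
  | nil => rfl
  | cons j L ih => simp [iteratedIntegral, ← Fin.cons_update, ih]

lemma setIntegral_Icc_fin_succ {Φ : (Fin (n + 1) → ℝ) → ℝ} (hΦ : Continuous Φ)
    (a : Fin (n + 1) → ℝ) :
    ∫ v in Set.Icc 0 a, Φ v =
      ∫ t in Set.Icc 0 (a 0), ∫ w in Set.Icc 0 (Fin.tail a), Φ (Fin.cons t w) := by
  have hmp := (volume_preserving_piFinSuccAbove (fun _ : Fin (n + 1) => ℝ) 0).symm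
  have hpre : (MeasurableEquiv.piFinSuccAbove (fun _ : Fin (n + 1) => ℝ) 0).symm ⁻¹'
      Set.Icc 0 a = Set.Icc 0 (a 0) ×ˢ Set.Icc 0 (Fin.tail a) := by
    ext ⟨t, w⟩
    simp only [Set.mem_preimage, Set.mem_Icc, Set.mem_prod, Pi.le_def, Fin.forall_fin_succ]
    simp [MeasurableEquiv.piFinSuccAbove, Fin.insertNthEquiv, Fin.tail]
    tauto
  rw [← hmp.setIntegral_preimage_emb (MeasurableEquiv.measurableEmbedding _), hpre,
    Measure.volume_eq_prod, setIntegral_prod]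
  · simp [MeasurableEquiv.piFinSuccAbove, Fin.insertNthEquiv]
  · refine ContinuousOn.integrableOn_compact (isCompact_Icc.prod isCompact_Icc) ?_
    have hcons : Continuous fun p : ℝ × (Fin n → ℝ) => (Fin.cons p.1 p.2 : Fin (n + 1) → ℝ) :=
      Continuous.finCons (A := fun _ => ℝ) continuous_fst continuous_snd
    refine (hΦ.comp hcons).continuousOn.congr fun p _ => ?_
    simp [MeasurableEquiv.piFinSuccAbove, Fin.insertNthEquiv]

lemma iteratedIntegral_finRange (u : Fin n → ℝ → ℝ) {Φ : (Fin n → ℝ) → ℝ} (hΦ : Continuous Φ)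
    (q : Fin n → ℝ) (hq : ∀ j, 0 ≤ u j (q j)) :
    iteratedIntegral u Φ (List.finRange n) q = ∫ v in Set.Icc 0 (fun j => u j (q j)), Φ v := by
  induction n with
  | zero =>
    have huniv : Set.Icc (0 : Fin 0 → ℝ) (fun j => u j (q j)) = Set.univ :=
      Set.eq_univ_of_forall fun v => by simp
    rw [huniv, Measure.restrict_univ, Measure.volume_pi_eq_dirac q, integral_dirac]
    rfl
  | succ n ih =>
    rw [List.finRange_succ, setIntegral_Icc_fin_succ hΦ, iteratedIntegral,
      intervalIntegral.integral_of_le (hq 0), ← integral_Icc_eq_integral_Ioc]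
    refine integral_congr_ae (Filter.Eventually.of_forall fun t => ?_)
    have hcons : Function.update q 0 t = Fin.cons t (Fin.tail q) := by
      rw [← Fin.cons_self_tail q, Fin.update_cons_zero, Fin.tail_cons]
    have hΦt : Continuous fun w : Fin n → ℝ => Φ (Fin.cons t w) :=
      hΦ.comp (continuous_const.finCons continuous_id)
    simp only [hcons]
    rw [iteratedIntegral_map_succ, ih _ hΦt (Fin.tail q) fun j => hq j.succ]
    rfl

lemma hasMixedPartialOn_iteratedIntegral (S : Set (Fin n → ℝ)) (l : Finset (Fin n))
    {Φ : (Fin n → ℝ) → ℝ} (hΦ : Continuous Φ) (L : List (Fin n)) :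
    HasMixedPartialOn S (iteratedIntegral (fun j x => if j ∈ l then x else 1) Φ L) L
      (fun q => if ∀ j ∈ L, j ∈ l then Φ q else 0) := by
  have hu : ∀ j, Continuous fun x : ℝ => if j ∈ l then x else 1 := fun j => by
    split_ifs <;> fun_prop
  induction L with
  | nil => exact fun q _ => by simp [iteratedIntegral]
  | cons j L ih =>
    by_cases hj : j ∈ l
    · refine ⟨_, fun q _ => ?_, by simpa [hj] using ih⟩
      have hcont : Continuous fun s : ℝ => iteratedIntegral (fun j x => if j ∈ l then x else 1) Φ L
          (Function.update q j s) :=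
        (continuous_iteratedIntegral hu hΦ L).comp (continuous_const.update j continuous_id)
      have hderiv := hcont.integral_hasStrictDerivAt 0 (q j)
      simpa [HasPartialDerivAt, iteratedIntegral, hj] using hderiv.hasDerivAt
    · refine ⟨fun _ => 0, fun q _ => ?_, by simpa [hj] using hasMixedPartialOn_zero L⟩
      simpa [HasPartialDerivAt, iteratedIntegral, hj] using hasDerivAt_const (q j) _

end IteratedIntegral

/-- with `f > 0` continuous, `m` continuous,
`G(q) = ∑_{l∈𝔏} c_l ∫_{A_l(q)} m(v) f(v) dv` where the family `𝔏` of distinct nonempty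
subsets contains the full set `l̃ = 𝐉` and has nonzero coefficients, the mixed partial
`∂^J G/∂q_1⋯∂q_J` exists on `(0,1)^J` and
`m(v) = (1/(c_{l̃} f(v))) ∂^J G/∂q_1⋯∂q_J (v)`: `m` is point identified from `G`, `f`. -/
theorem marginal_treatment_response_point_identified (J : ℕ) (hJ : 1 ≤ J)
    (f : (Fin J → ℝ) → ℝ) (hf : ContinuousOn f (Set.Icc 0 1)) (hfpos : ∀ v, 0 < f v)
    (m : (Fin J → ℝ) → ℝ) (hm : ContinuousOn m (Set.Icc 0 1))
    (𝔏 : Finset (Finset (Fin J))) (h𝔏 : ∀ l ∈ 𝔏, l.Nonempty)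
    (hfull : (Finset.univ : Finset (Fin J)) ∈ 𝔏)
    (c : Finset (Fin J) → ℝ) (hc : ∀ l ∈ 𝔏, c l ≠ 0)
    (G : (Fin J → ℝ) → ℝ)
    (hG : ∀ q : Fin J → ℝ,
      G q = ∑ l ∈ 𝔏, c l * ∫ v in Set.Icc (0 : Fin J → ℝ) (alphaCorner l q), m v * f v) :
    ∃ h : (Fin J → ℝ) → ℝ,
      HasMixedPartialOn (Set.univ.pi fun _ : Fin J => Set.Ioo (0 : ℝ) 1)
        G (List.finRange J) h ∧
      ∀ v ∈ Set.univ.pi fun _ : Fin J => Set.Ioo (0 : ℝ) 1,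
        m v = (1 / (c (Finset.univ : Finset (Fin J)) * f v)) * h v := by
  set S := Set.univ.pi fun _ : Fin J => Set.Ioo (0 : ℝ) 1
  have hS : IsOpen S := isOpen_set_pi Set.finite_univ fun _ _ => isOpen_Ioo
  have hSIcc : S ⊆ Set.Icc 0 1 := fun q hq =>
    ⟨fun j => (hq j trivial).1.le, fun j => (hq j trivial).2.le⟩
  obtain ⟨Φ, hΦ, hΦeq⟩ : ∃ Φ : (Fin J → ℝ) → ℝ, Continuous Φ ∧
      ∀ v ∈ Set.Icc (0 : Fin J → ℝ) 1, Φ v = m v * f v := by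
    refine ⟨fun v => m (0 ⊔ v ⊓ 1) * f (0 ⊔ v ⊓ 1), ?_, fun v hv => ?_⟩
    · refine (hm.mul hf).comp_continuous (f := fun v : Fin J → ℝ => 0 ⊔ v ⊓ 1)
        (continuous_pi fun j =>
          continuous_const.sup ((continuous_apply j).inf continuous_const)) ?_
      exact fun v => ⟨le_sup_left, sup_le zero_le_one inf_le_right⟩
    · simp only [inf_eq_left.2 hv.2, sup_eq_right.2 hv.1]
  have hGeq : Set.EqOn G (fun q => ∑ l ∈ 𝔏, c l *
      iteratedIntegral (fun j x => if j ∈ l then x else 1) Φ (List.finRange J) q) S := by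
    intro q hq
    simp only [hG q]
    refine Finset.sum_congr rfl fun l _ => ?_
    have hpos : ∀ j, 0 ≤ if j ∈ l then q j else 1 := fun j => by
      split_ifs
      exacts [(hSIcc hq).1 j, zero_le_one]
    have hle : alphaCorner l q ≤ 1 := fun j => by
      unfold alphaCorner
      split_ifs
      exacts [(hSIcc hq).2 j, le_rfl]
    rw [iteratedIntegral_finRange _ hΦ q hpos]
    congr 1
    exact setIntegral_congr_fun measurableSet_Icc fun v hv =>
      (hΦeq v ⟨hv.1, hv.2.trans hle⟩).symm
  refine ⟨_, (HasMixedPartialOn.sum_const_mul 𝔏 c fun l _ =>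
    hasMixedPartialOn_iteratedIntegral S l hΦ (List.finRange J)).congr hS hGeq, fun v hv => ?_⟩
  have hsum : (∑ l ∈ 𝔏, c l * if ∀ j ∈ List.finRange J, j ∈ l then Φ v else 0) =
      c Finset.univ * (m v * f v) := by
    rw [Finset.sum_eq_single_of_mem _ hfull]
    · simp [hΦeq v (hSIcc hv)]
    · intro l _ hl
      simp [← Finset.eq_univ_iff_forall, hl]
  rw [hsum]
  have hcne := hc _ hfull
  have hfne := (hfpos v).ne'
  field_simp
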